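/- A simplicial map F : Y → X between decomposition objects in a category C is CULF if and only if it is cartesian on the unique active map [1] → [2]; that is, F is cartesian on every active map of Δ if and only if the naturality square of F at d^1 : [1] → [2] (with horizontal edges d_1 : Y_2 → Y_1 and d_1 : X_2 → X_1) is a pullback. -/

import Mathlib

open CategoryTheory CategoryTheory.Limits Simplicial Opposite

/-- A morphism of the simplex category is *active* (generic) if it preserves endpoints. -/
def IsActive {x y : SimplexCategory} (f : x ⟶ y) : Prop :=
  f.toOrderHom 0 = 0 ∧ f.toOrderHom (Fin.last x.len) = Fin.last y.len

/-- A morphism of the simplex category is *inert* (free) if it is distance-preserving. -/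
def IsInert {x y : SimplexCategory} (f : x ⟶ y) : Prop :=
  ∀ i : Fin x.len, (f.toOrderHom i.succ : ℕ) = (f.toOrderHom i.castSucc : ℕ) + 1

variable {C : Type*} [Category C]

/-- A simplicial object is a *decomposition object* if it sends every pushout in `Δ` of
an active map along an inert map to a pullback square. -/
def IsDecomp (X : SimplicialObject C) : Prop :=
  ∀ ⦃n m k p : SimplexCategory⦄ (f : n ⟶ m) (g : n ⟶ k) (r : m ⟶ p) (s : k ⟶ p),
    IsInert f → IsActive g → IsPushout f g r s →
    IsPullback (X.map r.op) (X.map s.op) (X.map f.op) (X.map g.op)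

/-- A simplicial map is *cartesian* on an arrow `α` of `Δ` if the corresponding
naturality square is a pullback. -/
def CartesianOn {X Y : SimplicialObject C} (F : Y ⟶ X)
    {x y : SimplexCategory} (α : x ⟶ y) : Prop :=
  IsPullback (Y.map α.op) (F.app (op y)) (F.app (op x)) (X.map α.op)

/-- A simplicial map is *ULF* if it is cartesian on every inner coface map. -/
def IsULF {X Y : SimplicialObject C} (F : Y ⟶ X) : Prop :=
  ∀ (n i : ℕ) (_ : 0 < i) (hi : i < n + 1), CartesianOn F (SimplexCategory.δ (⟨i, by omega⟩ : Fin (n + 2)))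

/-- A simplicial map is *conservative* if it is cartesian on every codegeneracy map. -/
def IsConservative {X Y : SimplicialObject C} (F : Y ⟶ X) : Prop :=
  ∀ (n : ℕ) (i : Fin (n + 1)), CartesianOn F (SimplexCategory.σ i)

/-- A simplicial map is *CULF* if it is cartesian on every active map of `Δ`. -/
def IsCULF {X Y : SimplicialObject C} (F : Y ⟶ X) : Prop :=
  ∀ ⦃x y : SimplexCategory⦄ (α : x ⟶ y), IsActive α → CartesianOn F α

section InnerCoface

open SimplexCategory

lemma subinterval_two_apply_zero {n : ℕ} (i : Fin n) :
    (subinterval (n := n + 1) i 2 (by omega)).toOrderHom 0 =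
      i.succ.castSucc.succAbove i.castSucc := by
  rw [Fin.succAbove_of_castSucc_lt _ _ (by simp [Fin.lt_def])]
  exact Fin.ext (Nat.zero_add _)

lemma subinterval_two_apply_one {n : ℕ} (i : Fin n) :
    (subinterval (n := n + 1) i 2 (by omega)).toOrderHom 1 = i.succ.castSucc := by
  exact Fin.ext (Nat.add_comm 1 _)

lemma subinterval_two_apply_two {n : ℕ} (i : Fin n) :
    (subinterval (n := n + 1) i 2 (by omega)).toOrderHom 2 =
      i.succ.castSucc.succAbove i.succ := by
  rw [Fin.succAbove_of_le_castSucc _ _ le_rfl]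
  exact Fin.ext (Nat.add_comm 2 _)

/-- Glue a map out of `⦋n⦌` and a map out of `⦋2⦌` agreeing on an elementary interval
into a map out of `⦋n + 1⦌`. -/
def innerCofaceDesc {n : ℕ} (i : Fin n) {z : SimplexCategory} (h : ⦋n⦌ ⟶ z) (k : ⦋2⦌ ⟶ z)
    (w : mkOfSucc i ≫ h = SimplexCategory.δ (1 : Fin 3) ≫ k) : ⦋n + 1⦌ ⟶ z :=
  Hom.mk
    { toFun := i.succ.castSucc.insertNth (α := fun _ => Fin (z.len + 1))
        (k.toOrderHom 1) h.toOrderHom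
      monotone' := by
        have h₀ : h.toOrderHom i.castSucc = k.toOrderHom 0 := congr_toOrderHom_apply w 0
        have h₁ : h.toOrderHom i.succ = k.toOrderHom 2 := congr_toOrderHom_apply w 1
        have k₀ : k.toOrderHom 0 ≤ k.toOrderHom 1 := k.toOrderHom.monotone (by decide)
        have k₁ : k.toOrderHom 1 ≤ k.toOrderHom 2 := k.toOrderHom.monotone (by decide)
        intro a b
        induction a using Fin.succAboveCases i.succ.castSucc with
        | x =>
          induction b using Fin.succAboveCases i.succ.castSucc with
          | x => simp
          | p b =>
            intro hab
            have hb : i.succ ≤ b := by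
              by_contra! hb
              rw [Fin.succAbove_of_castSucc_lt _ _ (Fin.castSucc_lt_castSucc_iff.2 hb)] at hab
              exact absurd hab (Fin.castSucc_lt_castSucc_iff.2 hb).not_ge
            simp only [Fin.insertNth_apply_same, Fin.insertNth_apply_succAbove]
            exact (k₁.trans h₁.ge).trans (h.toOrderHom.monotone hb)
        | p a =>
          induction b using Fin.succAboveCases i.succ.castSucc with
          | x =>
            intro hab
            have ha : a ≤ i.castSucc := by
              by_contra! ha
              have ha' : i.succ ≤ a := Fin.castSucc_lt_iff_succ_le.mp ha
              rw [Fin.succAbove_of_le_castSucc _ _ (Fin.castSucc_le_castSucc_iff.2 ha')] at hab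
              simp only [Fin.le_def, Fin.val_succ, Fin.val_castSucc] at hab ha'
              omega
            simp only [Fin.insertNth_apply_same, Fin.insertNth_apply_succAbove]
            exact (h.toOrderHom.monotone ha).trans (h₀.le.trans k₀)
          | p b =>
            intro hab
            simp only [Fin.insertNth_apply_succAbove]
            exact h.toOrderHom.monotone ((Fin.strictMono_succAbove _).le_iff_le.mp hab) }

lemma isPushout_innerCoface {n : ℕ} (i : Fin n) :
    IsPushout (mkOfSucc i) (SimplexCategory.δ (1 : Fin 3)) (SimplexCategory.δ i.succ.castSucc)
      (subinterval (n := n + 1) i 2 (by omega)) := by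
  refine ⟨⟨?_⟩, ⟨PushoutCocone.IsColimit.mk _ (fun s => innerCofaceDesc i s.inl s.inr s.condition)
    (fun s => ?_) (fun s => ?_) (fun s m h₁ h₂ => ?_)⟩⟩
  · exact Hom.ext_one_left _ _ (subinterval_two_apply_zero i).symm
      (subinterval_two_apply_two i).symm
  · ext j : 3
    exact Fin.insertNth_apply_succAbove (α := fun _ => Fin (s.pt.len + 1)) _ _ _ j
  · have hs (j : Fin 2) := congr_toOrderHom_apply s.condition j
    ext j : 3
    change i.succ.castSucc.insertNth (α := fun _ => Fin (s.pt.len + 1)) _ _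
      ((subinterval (n := n + 1) i 2 (by omega)).toOrderHom j) = _
    fin_cases j
    · refine (congrArg _ (subinterval_two_apply_zero i)).trans ?_
      rw [Fin.insertNth_apply_succAbove]
      exact hs 0
    · refine (congrArg _ (subinterval_two_apply_one i)).trans ?_
      rw [Fin.insertNth_apply_same]
      rfl
    · refine (congrArg _ (subinterval_two_apply_two i)).trans ?_
      rw [Fin.insertNth_apply_succAbove]
      exact hs 1
  · ext j : 3
    change m.toOrderHom j = i.succ.castSucc.insertNth (α := fun _ => Fin (s.pt.len + 1)) _ _ j
    induction j using Fin.succAboveCases i.succ.castSucc with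
    | x =>
      rw [Fin.insertNth_apply_same, ← congr_toOrderHom_apply h₂ 1]
      exact congrArg m.toOrderHom (subinterval_two_apply_one i).symm
    | p j =>
      rw [Fin.insertNth_apply_succAbove, ← congr_toOrderHom_apply h₁ j]
      rfl

lemma isInert_mkOfSucc {n : ℕ} (i : Fin n) : IsInert (mkOfSucc i) := by
  intro j
  obtain rfl : j = 0 := Subsingleton.elim (α := Fin 1) _ _
  rfl

lemma isActive_δ_one : IsActive (SimplexCategory.δ (1 : Fin 3)) := ⟨rfl, rfl⟩

end InnerCoface

section CartesianOn

variable {X Y : SimplicialObject C} {F : Y ⟶ X}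

lemma CartesianOn.comp {x y z : SimplexCategory} {α : x ⟶ y} {β : y ⟶ z}
    (hα : CartesianOn F α) (hβ : CartesianOn F β) : CartesianOn F (α ≫ β) := by
  unfold CartesianOn
  simpa using IsPullback.paste_horiz hβ hα

lemma CartesianOn.of_comp {x y z : SimplexCategory} {α : x ⟶ y} {β : y ⟶ z}
    (hαβ : CartesianOn F (α ≫ β)) (hα : CartesianOn F α) : CartesianOn F β := by
  unfold CartesianOn at hαβ
  simp only [op_comp, Functor.map_comp] at hαβ
  exact IsPullback.of_right hαβ (F.naturality _) hα

lemma cartesianOn_of_isIso {x y : SimplexCategory} (α : x ⟶ y) [IsIso α] :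
    CartesianOn F α :=
  IsPullback.of_horiz_isIso ⟨F.naturality _⟩

lemma CartesianOn.of_isPushout (hY : IsDecomp Y) (hX : IsDecomp X)
    {n m k p : SimplexCategory} {f : n ⟶ m} {g : n ⟶ k} {r : m ⟶ p} {s : k ⟶ p}
    (hf : IsInert f) (hg : IsActive g) (sq : IsPushout f g r s) (h : CartesianOn F g) :
    CartesianOn F r := by
  have key := (hY f g r s hf hg sq).paste_vert h
  rw [F.naturality, F.naturality] at key
  exact IsPullback.of_bot key (F.naturality _) (hX f g r s hf hg sq)

lemma isPullback_of_retract {P A B D P' A' B' D' : C}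
    {fst : P ⟶ A} {snd : P ⟶ B} {f : A ⟶ D} {g : B ⟶ D}
    {fst' : P' ⟶ A'} {snd' : P' ⟶ B'} {f' : A' ⟶ D'} {g' : B' ⟶ D'}
    (h : IsPullback fst' snd' f' g') (w : fst ≫ f = snd ≫ g)
    (rP : Retract P P') (rA : Retract A A') (rB : Retract B B') (iD : D ⟶ D')
    (i_fst : rP.i ≫ fst' = fst ≫ rA.i) (i_snd : rP.i ≫ snd' = snd ≫ rB.i)
    (i_f : rA.i ≫ f' = f ≫ iD) (i_g : rB.i ≫ g' = g ≫ iD)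
    (r_fst : rP.r ≫ fst = fst' ≫ rA.r) (r_snd : rP.r ≫ snd = snd' ≫ rB.r) :
    IsPullback fst snd f g := by
  refine ⟨⟨w⟩, ⟨PullbackCone.IsLimit.mk _
    (fun s => h.lift (s.fst ≫ rA.i) (s.snd ≫ rB.i)
      (by simp only [Category.assoc, i_f, i_g, s.condition_assoc]) ≫ rP.r)
    (fun s => by simp [r_fst]) (fun s => by simp [r_snd]) (fun s m h₁ h₂ => ?_)⟩⟩
  rw [← Category.comp_id m, ← rP.retract, ← Category.assoc]
  congr 1
  apply h.hom_ext <;> simp [i_fst, i_snd, reassoc_of% h₁, reassoc_of% h₂]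

lemma CartesianOn.of_retract {x y x' y' : SimplexCategory} {α : x ⟶ y} {β : x' ⟶ y'}
    (h : CartesianOn F β) (rx : Retract x x') (ry : Retract y y')
    (hi : rx.i ≫ β = α ≫ ry.i) (hr : rx.r ≫ α = β ≫ ry.r) : CartesianOn F α := by
  have map_eq (Z : SimplicialObject C) {a b : SimplexCategory} {f g : a ⟶ b} (e : f = g) :
      Z.map f.op = Z.map g.op := by rw [e]
  have retract_map (Z : SimplicialObject C) {a b : SimplexCategory} (r : Retract a b) :
      Z.map r.r.op ≫ Z.map r.i.op = 𝟙 _ := by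
    rw [← Z.map_comp, ← op_comp, r.retract, op_id, Z.map_id]
  have hiY := map_eq Y hi
  have hrY := map_eq Y hr
  have hrX := map_eq X hr
  have hiX := map_eq X hi
  simp only [op_comp, Functor.map_comp] at hiY hrY hrX hiX
  exact isPullback_of_retract h (F.naturality _)
    ⟨Y.map ry.r.op, Y.map ry.i.op, retract_map Y ry⟩
    ⟨Y.map rx.r.op, Y.map rx.i.op, retract_map Y rx⟩
    ⟨X.map ry.r.op, X.map ry.i.op, retract_map X ry⟩ (X.map rx.r.op)
    hrY.symm (F.naturality _) (F.naturality _) hrX.symm hiY.symm (F.naturality _)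

lemma cartesianOn_σ_zero (h : CartesianOn F (SimplexCategory.σ (0 : Fin 2))) :
    CartesianOn F (SimplexCategory.σ (0 : Fin 1)) :=
  h.of_retract
    ⟨SimplexCategory.δ (2 : Fin 3), SimplexCategory.σ (1 : Fin 2), by decide⟩
    ⟨SimplexCategory.δ (1 : Fin 2), SimplexCategory.σ (0 : Fin 1), by decide⟩
    (by decide) (by decide)

lemma cartesianOn_δ (hY : IsDecomp Y) (hX : IsDecomp X)
    (h : CartesianOn F (SimplexCategory.δ (1 : Fin 3))) {n : ℕ} (p : Fin (n + 2))
    (h₀ : p ≠ 0) (h₁ : p ≠ Fin.last _) : CartesianOn F (SimplexCategory.δ p) := by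
  obtain ⟨q, rfl⟩ := Fin.eq_castSucc_of_ne_last h₁
  obtain ⟨i, rfl⟩ := Fin.eq_succ_of_ne_zero (i := q) (by rintro rfl; exact h₀ rfl)
  exact h.of_isPushout hY hX (isInert_mkOfSucc i) isActive_δ_one (isPushout_innerCoface i)

lemma CartesianOn.of_section {x y : SimplexCategory} {α : x ⟶ y} {β : y ⟶ x}
    (hα : CartesianOn F α) (w : α ≫ β = 𝟙 x) : CartesianOn F β :=
  CartesianOn.of_comp (by rw [w]; exact cartesianOn_of_isIso _) hα

lemma cartesianOn_σ (hY : IsDecomp Y) (hX : IsDecomp X)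
    (h : CartesianOn F (SimplexCategory.δ (1 : Fin 3))) {n : ℕ} (i : Fin (n + 1)) :
    CartesianOn F (SimplexCategory.σ i) := by
  by_cases hi : i = 0
  · subst hi
    cases n with
    | zero => exact cartesianOn_σ_zero (h.of_section SimplexCategory.δ_comp_σ_succ)
    | succ n =>
      refine (cartesianOn_δ hY hX h (Fin.succ 0) (Fin.succ_ne_zero _) ?_).of_section
        SimplexCategory.δ_comp_σ_succ
      simp [Fin.ext_iff]
  · exact (cartesianOn_δ hY hX h i.castSucc (by simpa using hi)
      (Fin.castSucc_ne_last i)).of_section SimplexCategory.δ_comp_σ_self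

end CartesianOn

section Active

lemma IsActive.of_σ_comp {n : ℕ} {z : SimplexCategory} {i : Fin (n + 1)} {θ : ⦋n⦌ ⟶ z}
    (h : IsActive (SimplexCategory.σ i ≫ θ)) : IsActive θ := by
  have e₀ : i.predAbove 0 = 0 := by simp
  have e₁ : i.predAbove (Fin.last (n + 1)) = Fin.last n := by simp
  exact ⟨(congrArg θ.toOrderHom e₀).symm.trans h.1, (congrArg θ.toOrderHom e₁).symm.trans h.2⟩

lemma IsActive.of_comp_δ {n : ℕ} {x : SimplexCategory} {p : Fin (n + 2)} {θ : x ⟶ ⦋n⦌}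
    (h : IsActive (θ ≫ SimplexCategory.δ p)) (h₀ : p ≠ 0) (h₁ : p ≠ Fin.last _) :
    IsActive θ :=
  ⟨Fin.succAbove_right_injective (p := p) (h.1.trans (Fin.succAbove_ne_zero_zero h₀).symm),
    Fin.succAbove_right_injective (p := p) (h.2.trans (Fin.succAbove_ne_last_last h₁).symm)⟩

/-- A property of morphisms of `Δ` that is stable under composition and holds for isomorphisms,
codegeneracies and inner cofaces holds for all active maps. -/
lemma IsActive.induction
    {P : ∀ ⦃x y : SimplexCategory⦄, (x ⟶ y) → Prop}
    (iso : ∀ ⦃x y : SimplexCategory⦄ (α : x ⟶ y), IsIso α → P α)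
    (comp : ∀ ⦃x y z : SimplexCategory⦄ (α : x ⟶ y) (β : y ⟶ z), P α → P β → P (α ≫ β))
    (codegeneracy : ∀ ⦃n : ℕ⦄ (i : Fin (n + 1)), P (SimplexCategory.σ i))
    (coface : ∀ ⦃n : ℕ⦄ (p : Fin (n + 2)), p ≠ 0 → p ≠ Fin.last _ → P (SimplexCategory.δ p)) :
    ∀ ⦃x y : SimplexCategory⦄ (α : x ⟶ y), IsActive α → P α := by
  intro x y α hα
  induction hN : x.len + y.len using Nat.strong_induction_on generalizing x y α with
  | _ N ih =>
    subst hN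
    by_cases hinj : Function.Injective α.toOrderHom
    · by_cases hsurj : Function.Surjective α.toOrderHom
      · exact iso α (SimplexCategory.isIso_of_bijective ⟨hinj, hsurj⟩)
      · obtain ⟨p, hp⟩ := not_forall.mp hsurj
        have hp := not_exists.mp hp
        have hp₀ : p ≠ 0 := fun h => hp 0 (hα.1.trans h.symm)
        have hp₁ : p ≠ Fin.last _ := fun h => hp (Fin.last _) (hα.2.trans h.symm)
        induction y using SimplexCategory.rec with
        | _ m =>
          cases m with
          | zero => exact absurd (Subsingleton.elim (α := Fin 1) _ _) hp₀
          | succ m =>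
            obtain ⟨θ, rfl⟩ := SimplexCategory.eq_comp_δ_of_not_surjective' α p hp
            exact comp _ _ (ih _ (by simp) θ (hα.of_comp_δ hp₀ hp₁) rfl) (coface p hp₀ hp₁)
    · induction x using SimplexCategory.rec with
      | _ n =>
        cases n with
        | zero => exact absurd (Function.injective_of_subsingleton (α := Fin 1) _) hinj
        | succ n =>
          obtain ⟨i, θ, rfl⟩ := SimplexCategory.eq_σ_comp_of_not_injective α hinj
          exact comp _ _ (codegeneracy i) (ih _ (by simp) θ hα.of_σ_comp rfl)

end Active

/-- A simplicial map between decomposition objects is CULF if and only if it is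
cartesian on the unique active map `[1] ⟶ [2]`, i.e. on `d^1 : [1] ⟶ [2]`. -/
theorem isCULF_iff_cartesianOn_d1 {X Y : SimplicialObject C} (F : Y ⟶ X)
    (hY : IsDecomp Y) (hX : IsDecomp X) :
    IsCULF F ↔ CartesianOn F (SimplexCategory.δ (1 : Fin 3)) :=
  ⟨fun h => h _ isActive_δ_one, fun h => IsActive.induction
    (fun _ _ α _ => cartesianOn_of_isIso α) (fun _ _ _ _ _ => CartesianOn.comp)
    (fun _ i => cartesianOn_σ hY hX h i) (fun _ p => cartesianOn_δ hY hX h p)⟩
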